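/- arXiv:2203.02496 — 2 statements merged into one kernel-verified Lean document; each statement's English description precedes it below -/
import Mathlib

section
/- Let C ≥ 1, let ℓ : Δ^C × {1,…,C} → ℝ be a loss that is continuous in its first argument on Δ^C and strictly proper, and let T ∈ ℝ^{C×C} be an invertible column-stochastic matrix. Then for every ε > 0 there exists δ > 0 such that for all η, q ∈ Δ^C: if ∑_{c=1}^C (Tη)_c (ℓ(Tq, c) − ℓ(Tη, c)) < δ, then η_{j(η)} − η_{j(q)} < ε. (Uniform calibration of the forward correction loss: a small excess inner forward-corrected surrogate risk under the noisy class-probability vector Tη forces a small excess inner 0-1 risk under the clean class-probability vector η, uniformly over η and q.) -/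
/-- The probability simplex in `ℝ^C`. -/
def simplex (C : ℕ) : Set (Fin C → ℝ) :=
  {p | (∀ i, 0 ≤ p i) ∧ ∑ i, p i = 1}

/-- The smallest index attaining the maximum of `q`. -/
noncomputable def jmax {C : ℕ} (hC : 0 < C) (q : Fin C → ℝ) : Fin C :=
  (Finset.univ.filter (fun i => ∀ k, q k ≤ q i)).min' (by
    haveI : Nonempty (Fin C) := ⟨⟨0, hC⟩⟩
    obtain ⟨b, -, hb⟩ := Finset.exists_max_image (Finset.univ : Finset (Fin C)) q
      Finset.univ_nonempty
    exact ⟨b, Finset.mem_filter.mpr ⟨Finset.mem_univ b, fun k => hb k (Finset.mem_univ k)⟩⟩)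

theorem isCompact_simplex (C : ℕ) : IsCompact (simplex C) :=
  isCompact_stdSimplex ℝ (Fin C)

theorem le_apply_jmax {C : ℕ} (hC : 0 < C) (q : Fin C → ℝ) (k : Fin C) :
    q k ≤ q (jmax hC q) := by
  have h : jmax hC q ∈ Finset.univ.filter (fun i => ∀ k, q k ≤ q i) := Finset.min'_mem _ _
  exact (Finset.mem_filter.mp h).2 k

theorem mulVec_mem_simplex {C : ℕ} {T : Matrix (Fin C) (Fin C) ℝ}
    (hTnn : ∀ i j, 0 ≤ T i j) (hTcol : ∀ j, ∑ i, T i j = 1)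
    {p : Fin C → ℝ} (hp : p ∈ simplex C) : T.mulVec p ∈ simplex C := by
  refine ⟨fun i => dotProduct_nonneg_of_nonneg (hTnn i) hp.1, ?_⟩
  simp only [Matrix.mulVec, dotProduct]
  rw [Finset.sum_comm]
  simp only [← Finset.sum_mul, hTcol, one_mul]
  exact hp.2

/-- The inner 0-1 regret is at most twice the sup distance of the probability vectors. -/
theorem apply_jmax_sub_le_two_mul_dist {C : ℕ} (hC : 0 < C) (η q : Fin C → ℝ) :
    η (jmax hC η) - η (jmax hC q) ≤ 2 * dist η q := by
  have h₁ := (abs_le.mp (Real.dist_eq _ _ ▸ dist_le_pi_dist η q (jmax hC η))).2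
  have h₂ := (abs_le.mp (Real.dist_eq _ _ ▸ dist_le_pi_dist η q (jmax hC q))).1
  linarith [le_apply_jmax hC q (jmax hC η)]

theorem stmt3 {C : ℕ} (hC : 0 < C) (ℓ : (Fin C → ℝ) → Fin C → ℝ)
    (hcont : ∀ c, ContinuousOn (fun q => ℓ q c) (simplex C))
    (hproper : ∀ p ∈ simplex C, ∀ q ∈ simplex C, q ≠ p →
      ∑ c, p c * ℓ p c < ∑ c, p c * ℓ q c)
    (T : Matrix (Fin C) (Fin C) ℝ)
    (hTnn : ∀ i j, 0 ≤ T i j) (hTcol : ∀ j, ∑ i, T i j = 1) (hTdet : IsUnit T.det) :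
    ∀ ε > (0 : ℝ), ∃ δ > (0 : ℝ), ∀ η ∈ simplex C, ∀ q ∈ simplex C,
      (∑ c, T.mulVec η c * (ℓ (T.mulVec q) c - ℓ (T.mulVec η) c)) < δ →
      η (jmax hC η) - η (jmax hC q) < ε := by
  intro ε hε
  set F : (Fin C → ℝ) × (Fin C → ℝ) → ℝ := fun x =>
    ∑ c, T.mulVec x.1 c * (ℓ (T.mulVec x.2) c - ℓ (T.mulVec x.1) c) with hF
  set K : Set ((Fin C → ℝ) × (Fin C → ℝ)) :=
    (simplex C ×ˢ simplex C) ∩ {x | ε / 2 ≤ dist x.1 x.2} with hK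
  have hKc : IsCompact K :=
    ((isCompact_simplex C).prod (isCompact_simplex C)).inter_right
      (isClosed_le continuous_const (continuous_fst.dist continuous_snd))
  have hT : Continuous T.mulVec := continuous_const.matrix_mulVec continuous_id
  have hFc : ContinuousOn F K := by
    refine continuousOn_finsetSum _ fun c _ => ContinuousOn.mul ?_ (ContinuousOn.sub ?_ ?_)
    · exact ((continuous_apply c).comp (hT.comp continuous_fst)).continuousOn
    · exact (hcont c).comp (hT.comp continuous_snd).continuousOn
        fun x hx => mulVec_mem_simplex hTnn hTcol hx.1.2
    · exact (hcont c).comp (hT.comp continuous_fst).continuousOn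
        fun x hx => mulVec_mem_simplex hTnn hTcol hx.1.1
  have hFpos : ∀ x ∈ K, 0 < F x := by
    intro x hx
    have hne : T.mulVec x.2 ≠ T.mulVec x.1 := fun h => by
      have h21 := Matrix.mulVec_injective_of_isUnit ((Matrix.isUnit_iff_isUnit_det T).mpr hTdet) h
      have hd : ε / 2 ≤ dist x.1 x.2 := hx.2
      rw [h21, dist_self] at hd
      linarith
    have := hproper _ (mulVec_mem_simplex hTnn hTcol hx.1.1) _
      (mulVec_mem_simplex hTnn hTcol hx.1.2) hne
    simp only [hF, mul_sub, Finset.sum_sub_distrib]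
    linarith
  obtain ⟨δ, hδ, hδF⟩ : ∃ δ > 0, ∀ x ∈ K, δ ≤ F x := by
    rcases K.eq_empty_or_nonempty with h | h
    · exact ⟨1, one_pos, by simp [h]⟩
    · obtain ⟨x, hx, hmin⟩ := hKc.exists_isMinOn h hFc
      exact ⟨F x, hFpos x hx, fun y hy => hmin hy⟩
  refine ⟨δ, hδ, fun η hη q hq hlt => ?_⟩
  by_contra! hge
  have hd : ε / 2 ≤ dist η q := by linarith [apply_jmax_sub_le_two_mul_dist hC η q]
  exact absurd (hδF (η, q) ⟨⟨hη, hq⟩, hd⟩) (not_le.mpr hlt)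
end

section
/- Let X be a set, N ≥ 1, C ≥ 1, let H be a set of functions X → ℝ^C, let x_1, …, x_N ∈ X, let w_1, …, w_N be positive reals, and for each i let λ_i : ℝ^C → ℝ be Lipschitz with constant L_i ≥ 0 with respect to the Euclidean norm on ℝ^C. Assume all suprema appearing below are finite. Then 2^{−N} ∑_{ε ∈ {−1,1}^N} sup_{f∈H} ∑_{i=1}^N ε_i w_i λ_i(f(x_i)) ≤ √2 · 2^{−NC} ∑_{ε ∈ {−1,1}^{N×C}} sup_{f∈H} ∑_{i=1}^N w_i L_i ∑_{c=1}^C ε_{i,c} f_c(x_i), where f_c(x) denotes the c-th coordinate of f(x). (Vector-valued Rademacher contraction inequality for a weighted sum of Lipschitz losses.) -/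
open scoped BigOperators

/-- The sign in `{-1, 1}` encoded by a Boolean. -/
def boolSign (b : Bool) : ℝ := if b then 1 else -1

lemma boolSign_not (b : Bool) : boolSign (!b) = -boolSign b := by
  cases b <;> simp [boolSign]

lemma exists_boolSign_mul_eq_abs (a : ℝ) : ∃ b, boolSign b * a = |a| := by
  rcases abs_choice a with h | h
  · exact ⟨true, by simp [boolSign, h]⟩
  · exact ⟨false, by simp [boolSign, h]⟩

lemma expect_bool (f : Bool → ℝ) : 𝔼 b, f b = (f true + f false) / 2 := by
  rw [Fintype.expect_eq_sum_div_card]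
  simp

lemma expect_fin_cons {α : Type*} [Fintype α] {n : ℕ} (f : (Fin (n + 1) → α) → ℝ) :
    𝔼 ε, f ε = 𝔼 a, 𝔼 ε : Fin n → α, f (Fin.cons a ε) := by
  rw [← Finset.expect_product', Finset.univ_product_univ]
  exact (Fintype.expect_equiv (Fin.consEquiv fun _ => α) _ _ fun _ => rfl).symm

lemma expect_le_expect_univ {α : Type*} [Fintype α] {f g : α → ℝ} (h : ∀ a, f a ≤ g a) :
    𝔼 a, f a ≤ 𝔼 a, g a :=
  Finset.expect_le_expect fun a _ => h a

lemma expect_boolSign_comp_not {n : ℕ} (f : (Fin n → Bool) → ℝ) :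
    𝔼 ε : Fin n → Bool, f (fun i => !ε i) = 𝔼 ε, f ε :=
  Fintype.expect_equiv (Equiv.arrowCongr (Equiv.refl _) Equiv.boolNot) _ _ fun _ => rfl

/-- The Dirichlet form `𝔼 f Lf` of the number operator `L` on the discrete cube. -/
noncomputable def cubeEnergy {n : ℕ} (f : (Fin n → Bool) → ℝ) : ℝ :=
  𝔼 ε : Fin n → Bool, ∑ i, f ε * (f ε - f (Function.update ε i (!ε i))) / 2

/-- The average of `f` over the first coordinate. -/
noncomputable def headMean {n : ℕ} (f : (Fin (n + 1) → Bool) → ℝ) (ε : Fin n → Bool) : ℝ :=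
  (f (Fin.cons true ε) + f (Fin.cons false ε)) / 2

/-- The discrete derivative of `f` in the first coordinate. -/
noncomputable def headDiff {n : ℕ} (f : (Fin (n + 1) → Bool) → ℝ) (ε : Fin n → Bool) : ℝ :=
  (f (Fin.cons true ε) - f (Fin.cons false ε)) / 2

section Decomposition

variable {n : ℕ} (f : (Fin (n + 1) → Bool) → ℝ)

lemma expect_eq_expect_headMean : 𝔼 ε, f ε = 𝔼 ε, headMean f ε := by
  rw [expect_fin_cons, expect_bool, ← Finset.expect_add_distrib, Finset.expect_div]
  rfl

lemma expect_sq_eq_headMean_add_headDiff :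
    𝔼 ε, f ε ^ 2 = 𝔼 ε, headMean f ε ^ 2 + 𝔼 ε, headDiff f ε ^ 2 := by
  rw [expect_eq_expect_headMean, ← Finset.expect_add_distrib]
  refine Finset.expect_congr rfl fun ε _ => ?_
  simp only [headMean, headDiff]
  ring

lemma expect_boolSign_zero_mul : 𝔼 ε, boolSign (ε 0) * f ε = 𝔼 ε, headDiff f ε := by
  rw [expect_eq_expect_headMean]
  refine Finset.expect_congr rfl fun ε _ => ?_
  simp only [headMean, headDiff, boolSign, Fin.cons_zero]
  simp
  ring

lemma expect_boolSign_succ_mul (i : Fin n) :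
    𝔼 ε, boolSign (ε i.succ) * f ε = 𝔼 ε, boolSign (ε i) * headMean f ε := by
  rw [expect_eq_expect_headMean]
  refine Finset.expect_congr rfl fun ε _ => ?_
  simp only [headMean, Fin.cons_succ]
  ring

lemma cubeEnergy_succ :
    cubeEnergy f = cubeEnergy (headMean f) + cubeEnergy (headDiff f) +
      𝔼 ε, headDiff f ε ^ 2 := by
  unfold cubeEnergy
  rw [expect_eq_expect_headMean, ← Finset.expect_add_distrib, ← Finset.expect_add_distrib]
  refine Finset.expect_congr rfl fun ε _ => ?_
  rw [headMean, Fin.sum_univ_succ, Fin.sum_univ_succ]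
  simp only [Fin.cons_zero, Fin.cons_succ, Fin.update_cons_zero, ← Fin.cons_update, Bool.not_true,
    Bool.not_false]
  have key : ∑ i, f (Fin.cons true ε) * (f (Fin.cons true ε) -
        f (Fin.cons true (Function.update ε i (!ε i)))) / 2 +
      ∑ i, f (Fin.cons false ε) * (f (Fin.cons false ε) -
        f (Fin.cons false (Function.update ε i (!ε i)))) / 2 =
      2 * (∑ i, headMean f ε * (headMean f ε - headMean f (Function.update ε i (!ε i))) / 2 +
        ∑ i, headDiff f ε * (headDiff f ε - headDiff f (Function.update ε i (!ε i))) / 2) := by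
    rw [← Finset.sum_add_distrib, ← Finset.sum_add_distrib, Finset.mul_sum]
    refine Finset.sum_congr rfl fun i _ => ?_
    simp only [headMean, headDiff]
    ring
  have hd : headDiff f ε ^ 2 = (f (Fin.cons true ε) * (f (Fin.cons true ε) -
      f (Fin.cons false ε)) / 2 + f (Fin.cons false ε) * (f (Fin.cons false ε) -
      f (Fin.cons true ε)) / 2) / 2 := by
    simp only [headDiff]
    ring
  rw [hd]
  linarith

end Decomposition

/-- The Poincaré inequality on the discrete cube. -/
lemma variance_le_cubeEnergy {n : ℕ} (f : (Fin n → Bool) → ℝ) :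
    𝔼 ε, f ε ^ 2 - (𝔼 ε, f ε) ^ 2 ≤ cubeEnergy f := by
  induction n with
  | zero => simp [cubeEnergy]
  | succ n ih =>
    have h₁ := ih (headMean f)
    have h₂ : 0 ≤ cubeEnergy (headDiff f) := by
      refine le_trans ?_ (ih (headDiff f))
      have h := Finset.expect_nonneg (s := Finset.univ)
        (f := fun ε => (headDiff f ε - 𝔼 ε, headDiff f ε) ^ 2) fun _ _ => sq_nonneg _
      simp only [sub_sq, Finset.expect_add_distrib, Finset.expect_sub_distrib,
        ← Finset.mul_expect, ← Finset.expect_mul, Finset.expect_const Finset.univ_nonempty] at h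
      linarith
    rw [expect_sq_eq_headMean_add_headDiff, expect_eq_expect_headMean, cubeEnergy_succ]
    linarith

/-- The Poincaré inequality on the discrete cube with constant improved to `2` away from the
first-order Walsh coefficients. -/
lemma two_mul_variance_sub_le_cubeEnergy {n : ℕ} (f : (Fin n → Bool) → ℝ) :
    2 * (𝔼 ε, f ε ^ 2 - (𝔼 ε, f ε) ^ 2) - ∑ i, (𝔼 ε, boolSign (ε i) * f ε) ^ 2 ≤
      cubeEnergy f := by
  induction n with
  | zero => simp [cubeEnergy]
  | succ n ih =>
    have h₁ := ih (headMean f)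
    have h₂ := variance_le_cubeEnergy (headDiff f)
    rw [expect_sq_eq_headMean_add_headDiff, expect_eq_expect_headMean, cubeEnergy_succ,
      Fin.sum_univ_succ, expect_boolSign_zero_mul]
    simp only [expect_boolSign_succ_mul]
    linarith

lemma expect_add_rademacher_sq {n : ℕ} (a : ℝ) (v : Fin n → ℝ) :
    𝔼 ε : Fin n → Bool, (a + ∑ i, boolSign (ε i) * v i) ^ 2 = a ^ 2 + ∑ i, v i ^ 2 := by
  induction n generalizing a with
  | zero => simp
  | succ n ih =>
    rw [expect_fin_cons]
    simp only [Fin.sum_univ_succ, Fin.cons_zero, Fin.cons_succ, ← add_assoc, ih]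
    rw [expect_bool]
    simp only [boolSign]
    simp
    ring

lemma sum_rademacher_update {n : ℕ} (v : Fin n → ℝ) (ε : Fin n → Bool) (i : Fin n) :
    ∑ j, boolSign (Function.update ε i (!ε i) j) * v j =
      ∑ j, boolSign (ε j) * v j - 2 * (boolSign (ε i) * v i) := by
  have h : ∀ j, boolSign (Function.update ε i (!ε i) j) * v j =
      boolSign (ε j) * v j - if j = i then 2 * (boolSign (ε i) * v i) else 0 := by
    intro j
    by_cases hj : j = i
    · subst hj
      simp [boolSign_not]
      ring
    · simp [hj]
  simp [h, Finset.sum_sub_distrib]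

lemma cubeEnergy_abs_rademacher_le {n : ℕ} (v : Fin n → ℝ) :
    cubeEnergy (fun ε => |∑ i, boolSign (ε i) * v i|) ≤
      𝔼 ε : Fin n → Bool, |∑ i, boolSign (ε i) * v i| ^ 2 := by
  refine expect_le_expect_univ fun ε => ?_
  simp only [sum_rademacher_update]
  set s := ∑ j, boolSign (ε j) * v j with hs
  have h : (n - 2 : ℝ) * |s| ≤ ∑ i, |s - 2 * (boolSign (ε i) * v i)| := by
    refine le_trans ?_ (Finset.abs_sum_le_sum_abs _ _)
    rw [Finset.sum_sub_distrib, ← Finset.mul_sum, ← hs]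
    simp only [Finset.sum_const, Finset.card_univ, Fintype.card_fin, nsmul_eq_mul]
    rw [← sub_mul, abs_mul]
    exact mul_le_mul_of_nonneg_right (le_abs_self _) (abs_nonneg _)
  rw [← Finset.sum_div, ← Finset.mul_sum, Finset.sum_sub_distrib]
  simp only [Finset.sum_const, Finset.card_univ, Fintype.card_fin, nsmul_eq_mul]
  nlinarith [abs_nonneg s]

/-- The `L¹`-`L²` Khintchine inequality of Szarek, with the optimal constant `√2`. -/
theorem sqrt_sum_sq_le_sqrt_two_mul_expect {n : ℕ} (v : Fin n → ℝ) :
    √(∑ i, v i ^ 2) ≤ √2 * 𝔼 ε : Fin n → Bool, |∑ i, boolSign (ε i) * v i| := by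
  have h₁ := two_mul_variance_sub_le_cubeEnergy fun ε => |∑ i, boolSign (ε i) * v i|
  have h₂ := cubeEnergy_abs_rademacher_le v
  have h₃ : ∀ i, 𝔼 ε : Fin n → Bool, boolSign (ε i) * |∑ i, boolSign (ε i) * v i| = 0 := by
    intro i
    have h := expect_boolSign_comp_not fun ε : Fin n → Bool =>
      boolSign (ε i) * |∑ i, boolSign (ε i) * v i|
    simp only [boolSign_not, neg_mul, Finset.sum_neg_distrib, abs_neg,
      Finset.expect_neg_distrib] at h
    linarith
  have h₄ : 𝔼 ε : Fin n → Bool, |∑ i, boolSign (ε i) * v i| ^ 2 = ∑ i, v i ^ 2 := by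
    simpa using expect_add_rademacher_sq 0 v
  have h₅ : 0 ≤ 𝔼 ε : Fin n → Bool, |∑ i, boolSign (ε i) * v i| :=
    Finset.expect_nonneg fun _ _ => abs_nonneg _
  simp only [h₃] at h₁
  rw [h₄] at h₁ h₂
  rw [← Real.sqrt_sq h₅, ← Real.sqrt_mul zero_le_two]
  refine Real.sqrt_le_sqrt ?_
  simp at h₁
  linarith

/-- The range of a real function is bounded in absolute value. -/
def AbsBounded {ι : Type*} (f : ι → ℝ) : Prop := ∃ B, ∀ a, |f a| ≤ B

namespace AbsBounded

variable {ι : Type*} {f g : ι → ℝ}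

lemma bddAbove (hf : AbsBounded f) : BddAbove (Set.range f) := by
  obtain ⟨B, hB⟩ := hf
  exact ⟨B, by rintro _ ⟨a, rfl⟩; exact (le_abs_self _).trans (hB a)⟩

lemma add (hf : AbsBounded f) (hg : AbsBounded g) : AbsBounded fun a => f a + g a := by
  obtain ⟨B, hB⟩ := hf
  obtain ⟨D, hD⟩ := hg
  exact ⟨B + D, fun a => (abs_add_le _ _).trans (add_le_add (hB a) (hD a))⟩

lemma const_mul (c : ℝ) (hf : AbsBounded f) : AbsBounded fun a => c * f a := by
  obtain ⟨B, hB⟩ := hf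
  exact ⟨|c| * B, fun a => by
    rw [abs_mul]
    exact mul_le_mul_of_nonneg_left (hB a) (abs_nonneg c)⟩

lemma sum {κ : Type*} {s : Finset κ} {F : κ → ι → ℝ} (hF : ∀ k, AbsBounded (F k)) :
    AbsBounded fun a => ∑ k ∈ s, F k a := by
  choose B hB using hF
  exact ⟨∑ k ∈ s, B k, fun a => (Finset.abs_sum_le_sum_abs _ _).trans
    (Finset.sum_le_sum fun k _ => hB k a)⟩

lemma of_rademacher {κ : Type*} [Fintype κ] {F : κ → ι → ℝ}
    (h : ∀ ε : κ → Bool, BddAbove (Set.range fun a => ∑ k, boolSign (ε k) * F k a)) (k : κ) :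
    AbsBounded (F k) := by
  classical
  choose B hB using h
  refine ⟨∑ ε, |B ε|, fun a => ?_⟩
  choose ε hε using fun k => exists_boolSign_mul_eq_abs (F k a)
  calc |F k a| ≤ ∑ k, |F k a| :=
        Finset.single_le_sum (f := fun k => |F k a|) (fun _ _ => abs_nonneg _) (Finset.mem_univ k)
    _ = ∑ k, boolSign (ε k) * F k a := by simp only [hε]
    _ ≤ B ε := hB ε ⟨a, rfl⟩
    _ ≤ |B ε| := le_abs_self _
    _ ≤ ∑ ε, |B ε| :=
        Finset.single_le_sum (f := fun ε => |B ε|) (fun _ _ => abs_nonneg _) (Finset.mem_univ ε)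

end AbsBounded

section Contraction

variable {ι : Type*} [Nonempty ι] {C : ℕ}

/-- Replacing a single scalar sign by a vector of signs. -/
lemma expect_iSup_contraction_single {G ψ : ι → ℝ} {φ : Fin C → ι → ℝ}
    (hG : AbsBounded G) (hφ : ∀ c, AbsBounded (φ c))
    (hlip : ∀ a b, ψ a - ψ b ≤ √(∑ c, (φ c a - φ c b) ^ 2)) :
    𝔼 e : Bool, ⨆ a, (G a + boolSign e * ψ a) ≤
      𝔼 ε : Fin C → Bool, ⨆ a, (G a + √2 * ∑ c, boolSign (ε c) * φ c a) := by
  let S : (Fin C → Bool) → ℝ := fun ε => ⨆ a, (G a + √2 * ∑ c, boolSign (ε c) * φ c a)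
  have hle : ∀ ε a, G a + √2 * ∑ c, boolSign (ε c) * φ c a ≤ S ε := fun ε a =>
    le_ciSup (f := fun a => G a + √2 * ∑ c, boolSign (ε c) * φ c a)
      (hG.add (.const_mul _ (.sum fun c => .const_mul _ (hφ c)))).bddAbove a
  have hneg : ∀ (ε : Fin C → Bool) a,
      G a - √2 * ∑ c, boolSign (ε c) * φ c a ≤ S (fun c => !ε c) := fun ε a => by
    have := hle (fun c => !ε c) a
    simp only [boolSign_not, neg_mul, Finset.sum_neg_distrib, mul_neg] at this
    linarith
  have hpair : ∀ a b, (G a + ψ a) + (G b - ψ b) ≤ 2 * 𝔼 ε, S ε := by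
    intro a b
    have hk := sqrt_sum_sq_le_sqrt_two_mul_expect fun c => φ c a - φ c b
    calc (G a + ψ a) + (G b - ψ b)
        ≤ (G a + G b) + √2 * 𝔼 ε : Fin C → Bool, |∑ c, boolSign (ε c) * (φ c a - φ c b)| := by
          linarith [hlip a b]
      _ = 𝔼 ε : Fin C → Bool,
            ((G a + G b) + √2 * |∑ c, boolSign (ε c) * (φ c a - φ c b)|) := by
          rw [Finset.expect_add_distrib, Finset.expect_const Finset.univ_nonempty,
            Finset.mul_expect]
      _ ≤ 𝔼 ε : Fin C → Bool, (S ε + S (fun c => !ε c)) := by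
          refine expect_le_expect_univ fun ε => ?_
          simp only [mul_sub, Finset.sum_sub_distrib]
          have h₁ := hle ε a
          have h₂ := hle ε b
          have h₃ := hneg ε a
          have h₄ := hneg ε b
          rcases abs_choice (∑ c, boolSign (ε c) * φ c a - ∑ c, boolSign (ε c) * φ c b)
            with h | h <;> rw [h] <;> linarith
      _ = 2 * 𝔼 ε, S ε := by
          rw [Finset.expect_add_distrib, expect_boolSign_comp_not]
          ring
  change _ ≤ 𝔼 ε, S ε
  rw [expect_bool]
  simp only [boolSign, if_true, Bool.false_eq_true, if_false, one_mul, neg_one_mul,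
    ← sub_eq_add_neg]
  have h₁ : ⨆ b, (G b - ψ b) ≤ 2 * 𝔼 ε, S ε - ⨆ a, (G a + ψ a) := by
    refine ciSup_le fun b => ?_
    have : ⨆ a, (G a + ψ a) ≤ 2 * 𝔼 ε, S ε - (G b - ψ b) :=
      ciSup_le fun a => by linarith [hpair a b]
    linarith
  linarith

/-- The Maurer vector contraction inequality for Rademacher averages. -/
theorem expect_iSup_contraction {N : ℕ} {G : ι → ℝ} {ψ : Fin N → ι → ℝ}
    {φ : Fin N → Fin C → ι → ℝ} (hG : AbsBounded G) (hψ : ∀ i, AbsBounded (ψ i))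
    (hφ : ∀ i c, AbsBounded (φ i c))
    (hlip : ∀ i a b, ψ i a - ψ i b ≤ √(∑ c, (φ i c a - φ i c b) ^ 2)) :
    𝔼 ε : Fin N → Bool, ⨆ a, (G a + ∑ i, boolSign (ε i) * ψ i a) ≤
      𝔼 ε : Fin N → Fin C → Bool,
        ⨆ a, (G a + √2 * ∑ i, ∑ c, boolSign (ε i c) * φ i c a) := by
  induction N generalizing G with
  | zero => simp
  | succ N ih =>
    rw [expect_fin_cons, expect_fin_cons]
    simp only [Fin.sum_univ_succ, Fin.cons_zero, Fin.cons_succ]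
    calc 𝔼 e : Bool, 𝔼 ε : Fin N → Bool,
          ⨆ a, (G a + (boolSign e * ψ 0 a + ∑ i : Fin N, boolSign (ε i) * ψ i.succ a))
        ≤ 𝔼 e : Bool, 𝔼 ε : Fin N → Fin C → Bool, ⨆ a, (G a + boolSign e * ψ 0 a +
            √2 * ∑ i : Fin N, ∑ c, boolSign (ε i c) * φ i.succ c a) := by
          refine expect_le_expect_univ fun e => ?_
          simp only [← add_assoc]
          exact ih (hG.add (.const_mul _ (hψ 0))) (fun i => hψ i.succ) (fun i => hφ i.succ)
            fun i => hlip i.succ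
      _ = 𝔼 ε : Fin N → Fin C → Bool, 𝔼 e : Bool, ⨆ a, ((G a +
            √2 * ∑ i : Fin N, ∑ c, boolSign (ε i c) * φ i.succ c a) +
              boolSign e * ψ 0 a) := by
          rw [Finset.expect_comm]
          simp only [add_right_comm]
      _ ≤ 𝔼 ε : Fin N → Fin C → Bool, 𝔼 e : Fin C → Bool, ⨆ a, ((G a +
            √2 * ∑ i : Fin N, ∑ c, boolSign (ε i c) * φ i.succ c a) +
              √2 * ∑ c, boolSign (e c) * φ 0 c a) := by
          refine expect_le_expect_univ fun ε => expect_iSup_contraction_single ?_ (hφ 0) (hlip 0)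
          exact hG.add (.const_mul _ (.sum fun i => .sum fun c => .const_mul _ (hφ i.succ c)))
      _ = 𝔼 e : Fin C → Bool, 𝔼 ε : Fin N → Fin C → Bool, ⨆ a, (G a +
            √2 * (∑ c, boolSign (e c) * φ 0 c a +
              ∑ i : Fin N, ∑ c, boolSign (ε i c) * φ i.succ c a)) := by
          rw [Finset.expect_comm]
          simp only [mul_add, add_right_comm, ← add_assoc]

end Contraction

theorem stmt17 {X : Type*} {N C : ℕ} (hN : 0 < N) (hC : 0 < C)
    (H : Set (X → (Fin C → ℝ))) (hH : H.Nonempty)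
    (x : Fin N → X) (w : Fin N → ℝ) (hw : ∀ i, 0 < w i)
    (lam : Fin N → (Fin C → ℝ) → ℝ) (L : Fin N → ℝ) (hL : ∀ i, 0 ≤ L i)
    (hlam : ∀ i, ∀ u v : Fin C → ℝ,
      |lam i u - lam i v| ≤ L i * Real.sqrt (∑ c, (u c - v c) ^ 2))
    (hbddL : ∀ ε : Fin N → Bool,
      BddAbove ((fun f => ∑ i, (if ε i then (1 : ℝ) else -1) * w i * lam i (f (x i))) '' H))
    (hbddR : ∀ ε : Fin N → Fin C → Bool,
      BddAbove ((fun f =>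
        ∑ i, w i * L i * ∑ c, (if ε i c then (1 : ℝ) else -1) * f (x i) c) '' H)) :
    (∑ ε : Fin N → Bool,
        sSup ((fun f => ∑ i, (if ε i then (1 : ℝ) else -1) * w i * lam i (f (x i))) '' H))
        / 2 ^ N
      ≤ Real.sqrt 2 *
        ((∑ ε : Fin N → Fin C → Bool,
          sSup ((fun f =>
            ∑ i, w i * L i * ∑ c, (if ε i c then (1 : ℝ) else -1) * f (x i) c) '' H))
          / 2 ^ (N * C)) := by
  have : Nonempty H := hH.to_subtype
  simp only [sSup_image']
  simp only [Set.image_eq_range] at hbddL hbddR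
  set ψ : Fin N → H → ℝ := fun i f => w i * lam i (f.1 (x i)) with hψ_def
  set φ : Fin N → Fin C → H → ℝ := fun i c f => w i * L i * f.1 (x i) c with hφ_def
  have eqL : ∀ (ε : Fin N → Bool) (f : H),
      ∑ i, (if ε i then (1 : ℝ) else -1) * w i * lam i (f.1 (x i)) =
        ∑ i, boolSign (ε i) * ψ i f := fun ε f =>
    Finset.sum_congr rfl fun i _ => mul_assoc _ _ _
  have eqR : ∀ (ε : Fin N → Fin C → Bool) (f : H),
      ∑ i, w i * L i * ∑ c, (if ε i c then (1 : ℝ) else -1) * f.1 (x i) c =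
        ∑ i, ∑ c, boolSign (ε i c) * φ i c f := fun ε f =>
    Finset.sum_congr rfl fun i _ => by
      rw [Finset.mul_sum]
      exact Finset.sum_congr rfl fun c _ => mul_left_comm _ _ _
  have hψ : ∀ i, AbsBounded (ψ i) := AbsBounded.of_rademacher fun ε => by
    simpa only [eqL] using hbddL ε
  have hφ : ∀ i c, AbsBounded (φ i c) := fun i c =>
    AbsBounded.of_rademacher (F := fun k : Fin N × Fin C => φ k.1 k.2)
      (fun ε => by
        simpa only [eqR, Fintype.sum_prod_type] using hbddR fun i c => ε (i, c)) (i, c)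
  have hlip : ∀ i a b, ψ i a - ψ i b ≤ √(∑ c, (φ i c a - φ i c b) ^ 2) := by
    intro i a b
    have hwL : 0 ≤ w i * L i := mul_nonneg (hw i).le (hL i)
    simp only [hψ_def, hφ_def, ← mul_sub, mul_pow, ← Finset.mul_sum]
    rw [← mul_pow, Real.sqrt_mul (sq_nonneg _), Real.sqrt_sq hwL, mul_assoc]
    exact mul_le_mul_of_nonneg_left ((le_abs_self _).trans (hlam i _ _)) (hw i).le
  have h := expect_iSup_contraction (G := fun _ : H => 0) ⟨0, by simp⟩ hψ hφ hlip
  simp only [zero_add, ← Real.mul_iSup_of_nonneg (Real.sqrt_nonneg 2), ← Finset.mul_expect] at h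
  simp only [eqL, eqR]
  simpa [Fintype.expect_eq_sum_div_card, ← pow_mul, mul_comm C N] using h
end
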